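/- Let (Ω, 𝒢, (𝒢_t)_{t≥0}, ℙ) be a filtered probability space and (Y_t)_{t≥0}, (Z_t)_{t≥0} two [0,∞)-valued (𝒢_t)-adapted processes; for a > 0 let S_a := inf{t ≥ 0 : Y_t ≤ a} and T_a := inf{t ≥ 0 : Z_t ≤ a}. Suppose: (1) there exist positive constants a, c₁, c₂ and r > 1 such that (Z_{t∧T_a} + c₁·(t∧T_a)) is a submartingale, (Z_{t∧T_a}^r − c₂·∫_0^{t∧T_a} Z_s^{r−1} ds) is a supermartingale, and Z_0 = z > a almost surely; (2) Y_0 = y almost surely and there exists b > 0 with ab < y < bz and Y_t ≤ b·Z_t almost surely for all t. If for some p > 0 the stopped process (Y_{t∧S_{ab}}^p)_{t≥0} is a submartingale, then E(T_a^q) = ∞ for all q > p. -/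

import Mathlib

open MeasureTheory Set Filter
open scoped ENNReal NNReal

/-- The hitting time `inf {t ≥ 0 : Y_t ≤ c}` (valued in `ℝ≥0∞`, infinite if
the level `c` is never reached). -/
noncomputable def hitTime {Ω : Type*} (Y : ℝ≥0 → Ω → ℝ) (c : ℝ) (ω : Ω) : ℝ≥0∞ :=
  sInf ((fun s : ℝ≥0 => (s : ℝ≥0∞)) '' {s : ℝ≥0 | Y s ω ≤ c})

/-- The stopped time `t ∧ T` where `T = hitTime Y c`. -/
noncomputable def stopAt {Ω : Type*} (Y : ℝ≥0 → Ω → ℝ) (c : ℝ) (t : ℝ≥0) (ω : Ω) : ℝ≥0 :=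
  (min (t : ℝ≥0∞) (hitTime Y c ω)).toNNReal

/-- A process has right-continuous paths. -/
def RightCts {Ω : Type*} (Y : ℝ≥0 → Ω → ℝ) : Prop :=
  ∀ (ω : Ω) (t : ℝ≥0), Filter.Tendsto (fun s => Y s ω) (nhdsWithin t (Set.Ici t)) (nhds (Y t ω))

/-- Accumulated integral. -/
noncomputable def JJ {Ω : Type*} (G : ℝ → Ω → ℝ≥0∞) (v : ℝ≥0) (ω : Ω) : ℝ≥0∞ :=
  ∫⁻ s in Set.Ioc (0:ℝ) (v:ℝ), G s ω

/-- Increment of the accumulated integral. -/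
noncomputable def DD {Ω : Type*} (G : ℝ → Ω → ℝ≥0∞) (t v : ℝ≥0) (ω : Ω) : ℝ :=
  (JJ G v ω).toReal - (JJ G t ω).toReal

lemma JJ_mono {Ω : Type*} (G : ℝ → Ω → ℝ≥0∞) {v w : ℝ≥0} (h : v ≤ w) (ω : Ω) :
    JJ G v ω ≤ JJ G w ω :=
  lintegral_mono_set (Set.Ioc_subset_Ioc_right (by exact_mod_cast h))

lemma JJ_add {Ω : Type*} (G : ℝ → Ω → ℝ≥0∞) {v w : ℝ≥0} (h : v ≤ w) (ω : Ω) :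
    JJ G w ω = JJ G v ω + ∫⁻ s in Set.Ioc (v:ℝ) (w:ℝ), G s ω := by
  unfold JJ
  rw [← lintegral_union measurableSet_Ioc, Set.Ioc_union_Ioc_eq_Ioc (NNReal.coe_nonneg v) (NNReal.coe_le_coe.2 h)]
  rw [Set.disjoint_left]
  intro x hx hx'
  exact absurd hx.2 (not_le.2 hx'.1)

lemma DD_ne_top {Ω : Type*} (G : ℝ → Ω → ℝ≥0∞) {t v : ℝ≥0} (ω : Ω)
    (hpos : 0 < DD G t v ω) : JJ G v ω ≠ ⊤ := by
  intro h
  unfold DD at hpos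
  rw [h] at hpos
  have := ENNReal.toReal_nonneg (a := JJ G t ω)
  simp at hpos
  linarith

lemma DD_mono {Ω : Type*} (G : ℝ → Ω → ℝ≥0∞) {t w v : ℝ≥0} (hwv : w ≤ v) (ω : Ω)
    (hpos : 0 < DD G t v ω) : DD G t w ω ≤ DD G t v ω := by
  have := ENNReal.toReal_mono (DD_ne_top G ω hpos) (JJ_mono G hwv ω)
  unfold DD
  linarith

lemma DD_le {Ω : Type*} (G : ℝ → Ω → ℝ≥0∞) {t v : ℝ≥0} (htv : t ≤ v) (ω : Ω)
    (hpos : 0 < DD G t v ω) :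
    ENNReal.ofReal (DD G t v ω) ≤ ∫⁻ s in Set.Ioc (t:ℝ) (v:ℝ), G s ω := by
  have h := DD_ne_top G ω hpos
  have h1 := JJ_add G htv ω
  have h2 : JJ G t ω ≠ ⊤ := ne_top_of_le_ne_top h (JJ_mono G htv ω)
  have h3 : (∫⁻ s in Set.Ioc (t:ℝ) (v:ℝ), G s ω) ≠ ⊤ := by
    intro h3; rw [h3] at h1; simp at h1; exact h h1
  unfold DD
  rw [h1, ENNReal.toReal_add h2 h3, add_sub_cancel_left, ENNReal.ofReal_toReal h3]

lemma DD_nonpos_of {Ω : Type*} (G : ℝ → Ω → ℝ≥0∞) {t v u : ℝ≥0} (hvu : v ≤ u) (ω : Ω)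
    {K : ℝ} (h1 : DD G t u ω ≤ K) (h2 : K < DD G t v ω) : DD G t u ω ≤ 0 := by
  by_contra hcon
  push Not at hcon
  have := DD_mono G hvu ω hcon
  linarith

lemma JJ_meas {Ω : Type*} {m : MeasurableSpace Ω} (G : ℝ → Ω → ℝ≥0∞)
    (hG : Measurable (Function.uncurry G)) :
    Measurable (fun x : ℝ × Ω => JJ G x.1.toNNReal x.2) := by
  have : (fun x : ℝ × Ω => JJ G x.1.toNNReal x.2) = fun x : ℝ × Ω =>
      ∫⁻ s : ℝ, {z : (ℝ × Ω) × ℝ | z.2 ∈ Set.Ioc 0 (z.1.1.toNNReal : ℝ)}.indicator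
        (fun z => G z.2 z.1.2) (x, s) := by
    ext x
    unfold JJ
    rw [← lintegral_indicator measurableSet_Ioc]
    rfl
  rw [this]
  apply Measurable.lintegral_prod_right'
    (f := {z : (ℝ × Ω) × ℝ | z.2 ∈ Set.Ioc 0 (z.1.1.toNNReal : ℝ)}.indicator
        (fun z => G z.2 z.1.2))
  apply Measurable.indicator
  · exact hG.comp (measurable_snd.prodMk (measurable_snd.comp measurable_fst))
  · apply MeasurableSet.inter
    · exact measurableSet_lt measurable_const measurable_snd
    · exact measurableSet_le measurable_snd (by fun_prop)

lemma sup_boot {ι : Type*} [Nonempty ι] (h : ι → ℝ) (D H0 : ℝ) (hb : ∀ i, h i ≤ H0)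
    (hstep : ∀ H, (∀ i, h i ≤ H) → ∀ i, h i ≤ D + H / 2) (i : ι) : h i ≤ 2 * D := by
  have hbd : BddAbove (Set.range h) := ⟨H0, by rintro _ ⟨i, rfl⟩; exact hb i⟩
  have h1 : ∀ i, h i ≤ ⨆ i, h i := fun i => le_ciSup hbd i
  have h2 : (⨆ i, h i) ≤ D + (⨆ i, h i) / 2 := ciSup_le (hstep _ h1)
  linarith [h1 i]

/-- One-step inequality. -/
lemma momA1 {Ω : Type*} {m : MeasurableSpace Ω}
    (𝒢 : MeasureTheory.Filtration ℝ≥0 m) (ℙ : Measure Ω) [IsProbabilityMeasure ℙ]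
    (X : ℝ≥0 → Ω → ℝ) (hXm : ∀ v, Measurable[𝒢 v] (X v)) (hXnn : ∀ v ω, 0 ≤ X v ω)
    (G : ℝ → Ω → ℝ≥0∞)
    (hIm : ∀ v, Measurable[𝒢 v] (fun ω => (JJ G v ω).toReal))
    (c₂ r : ℝ) (hc₂ : 0 < c₂)
    (hsup : Supermartingale (fun (t : ℝ≥0) (ω : Ω) => X t ω ^ r - c₂ * (JJ G t ω).toReal) 𝒢 ℙ)
    (t u : ℝ≥0) (A : Set Ω) (hA : MeasurableSet[𝒢 t] A)
    (K₀ K : ℝ) (hK : 0 ≤ K) (hAI : ∀ ω ∈ A, (JJ G t ω).toReal ≤ K₀)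
    (v : ℝ≥0) (htv : t ≤ v) (hvu : v ≤ u) :
    IntegrableOn (fun ω => X v ω ^ r) (A ∩ {ω | DD G t v ω ≤ K}) ℙ ∧
    IntegrableOn (fun ω => max (DD G t v ω) 0) (A ∩ {ω | DD G t v ω ≤ K}) ℙ ∧
    ∫ ω in A ∩ {ω | DD G t v ω ≤ K}, X v ω ^ r ∂ℙ ≤
      ∫ ω in A, X t ω ^ r ∂ℙ +
      ∫ ω in A ∩ {ω | K < DD G t u ω},
        |X u ω ^ r - c₂ * (JJ G u ω).toReal + c₂ * (JJ G t ω).toReal| ∂ℙ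
      + c₂ * ∫ ω in A ∩ {ω | DD G t v ω ≤ K}, max (DD G t v ω) 0 ∂ℙ := by
  have htu := htv.trans hvu
  have hAm : ∀ w, t ≤ w → MeasurableSet[𝒢 w] A := fun w hw => 𝒢.mono hw _ hA
  have hDm : ∀ w, t ≤ w → Measurable[𝒢 w] (DD G t w) := fun w hw =>
    (hIm w).sub ((hIm t).mono (𝒢.mono hw) le_rfl)
  have hA' : MeasurableSet A := 𝒢.le t _ hA
  have hD' : ∀ w, t ≤ w → Measurable (DD G t w) := fun w hw => (hDm w hw).mono (𝒢.le w) le_rfl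
  have hI' : ∀ w, Measurable (fun ω => (JJ G w ω).toReal) := fun w =>
    (hIm w).mono (𝒢.le w) le_rfl
  have hBm : MeasurableSet[𝒢 v] (A ∩ {ω | DD G t v ω ≤ K}) :=
    (hAm v htv).inter ((hDm v htv) measurableSet_Iic)
  have hCm : MeasurableSet[𝒢 v] (A ∩ {ω | K < DD G t v ω}) :=
    (hAm v htv).inter ((hDm v htv) measurableSet_Ioi)
  have hB' := 𝒢.le v _ hBm
  have hC' := 𝒢.le v _ hCm
  -- integrability of the initial integral on A
  have hIt : IntegrableOn (fun ω => c₂ * (JJ G t ω).toReal) A ℙ := by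
    apply Integrable.const_mul
    apply Measure.integrableOn_of_bounded (M := K₀) (measure_ne_top _ _)
      (hI' t).aestronglyMeasurable
    filter_upwards [ae_restrict_mem hA'] with ω hω
    rw [Real.norm_of_nonneg ENNReal.toReal_nonneg]
    exact hAI ω hω
  set M' : ℝ≥0 → Ω → ℝ := fun w ω =>
    X w ω ^ r - c₂ * (JJ G w ω).toReal + c₂ * (JJ G t ω).toReal with hM'
  have hM'i : ∀ w, IntegrableOn (M' w) A ℙ := fun w => ((hsup.integrable w).integrableOn).add hIt
  have hM'le : ∀ w₁ w₂, w₁ ≤ w₂ → ∀ S : Set Ω, S ⊆ A → MeasurableSet[𝒢 w₁] S →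
      ∫ ω in S, M' w₂ ω ∂ℙ ≤ ∫ ω in S, M' w₁ ω ∂ℙ := by
    intro w₁ w₂ hw S hSA hS
    simp only [hM']
    rw [integral_add (hsup.integrable w₂).integrableOn (hIt.mono_set hSA),
      integral_add (hsup.integrable w₁).integrableOn (hIt.mono_set hSA)]
    gcongr 1
    exact hsup.setIntegral_le hw hS
  have hDi : IntegrableOn (fun ω => max (DD G t v ω) 0) (A ∩ {ω | DD G t v ω ≤ K}) ℙ := by
    apply Measure.integrableOn_of_bounded (M := K) (measure_ne_top _ _)
      ((hD' v htv).max measurable_const).aestronglyMeasurable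
    filter_upwards [ae_restrict_mem hB'] with ω hω
    rw [Real.norm_of_nonneg (le_max_right _ _)]
    exact max_le hω.2 hK
  have hDi2 : IntegrableOn (fun ω => DD G t v ω) (A ∩ {ω | DD G t v ω ≤ K}) ℙ := by
    apply Measure.integrableOn_of_bounded (M := max K K₀) (measure_ne_top _ _)
      (hD' v htv).aestronglyMeasurable
    filter_upwards [ae_restrict_mem hB'] with ω hω
    rw [Real.norm_eq_abs, abs_le]
    constructor
    · have := hAI ω hω.1
      have h2 := ENNReal.toReal_nonneg (a := JJ G v ω)
      have := le_max_right K K₀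
      unfold DD
      linarith
    · exact (hω.2).trans (le_max_left _ _)
  have hXeq : ∀ w, (fun ω => X w ω ^ r) = fun ω => M' w ω + c₂ * DD G t w ω := by
    intro w
    ext ω
    simp only [hM', DD]
    ring
  refine ⟨?_, hDi, ?_⟩
  · rw [hXeq v]
    exact ((hM'i v).mono_set Set.inter_subset_left).add (hDi2.const_mul c₂)
  have e1 : ∫ ω in A ∩ {ω | DD G t v ω ≤ K}, X v ω ^ r ∂ℙ =
      ∫ ω in A ∩ {ω | DD G t v ω ≤ K}, M' v ω ∂ℙ
      + c₂ * ∫ ω in A ∩ {ω | DD G t v ω ≤ K}, DD G t v ω ∂ℙ := by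
    rw [hXeq v, integral_add ((hM'i v).mono_set Set.inter_subset_left) (hDi2.const_mul c₂),
      integral_const_mul]
  have e2 : ∫ ω in A ∩ {ω | DD G t v ω ≤ K}, DD G t v ω ∂ℙ ≤
      ∫ ω in A ∩ {ω | DD G t v ω ≤ K}, max (DD G t v ω) 0 ∂ℙ :=
    integral_mono hDi2 hDi (fun ω => le_max_left _ _)
  have e3 : ∫ ω in A, M' v ω ∂ℙ = ∫ ω in A ∩ {ω | DD G t v ω ≤ K}, M' v ω ∂ℙ +
      ∫ ω in A ∩ {ω | K < DD G t v ω}, M' v ω ∂ℙ := by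
    rw [← setIntegral_union _ hC' ((hM'i v).mono_set Set.inter_subset_left)
      ((hM'i v).mono_set Set.inter_subset_left)]
    · congr 2
      ext ω
      simp only [Set.mem_union, Set.mem_inter_iff, Set.mem_ofPred_eq]
      have := le_or_gt (DD G t v ω) K
      tauto
    · rw [Set.disjoint_left]
      intro ω h1 h2
      have a1 : DD G t v ω ≤ K := h1.2
      have a2 : K < DD G t v ω := h2.2
      linarith
  have e4 : ∫ ω in A, M' v ω ∂ℙ ≤ ∫ ω in A, X t ω ^ r ∂ℙ := by
    refine (hM'le t v htv A le_rfl hA).trans (le_of_eq ?_)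
    simp [hM']
  have e5 := hM'le v u hvu _ Set.inter_subset_left hCm
  have e6 : -∫ ω in A ∩ {ω | K < DD G t u ω}, |M' u ω| ∂ℙ ≤
      ∫ ω in A ∩ {ω | K < DD G t v ω}, M' u ω ∂ℙ := by
    have hE : MeasurableSet {ω | K < DD G t u ω} := (hD' u htu) measurableSet_Ioi
    have hi2 : IntegrableOn (({ω | K < DD G t u ω}).indicator (fun ω => |M' u ω|)) A ℙ :=
      Integrable.indicator (hM'i u).abs hE
    have : ∫ ω in A ∩ {ω | K < DD G t u ω}, |M' u ω| ∂ℙ =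
        ∫ ω in A, ({ω | K < DD G t u ω}).indicator (fun ω => |M' u ω|) ω ∂ℙ := by
      rw [setIntegral_indicator hE]
    rw [this]
    have h7 : ∫ ω in A ∩ {ω | K < DD G t v ω}, ({ω | K < DD G t u ω}).indicator (fun ω => |M' u ω|) ω ∂ℙ
        ≤ ∫ ω in A, ({ω | K < DD G t u ω}).indicator (fun ω => |M' u ω|) ω ∂ℙ := by
      apply setIntegral_mono_set hi2
      · exact Filter.Eventually.of_forall
          (fun ω => Set.indicator_nonneg (fun _ _ => abs_nonneg _) ω)
      · exact (Set.inter_subset_left).eventuallyLE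
    have h8 : ∫ ω in A ∩ {ω | K < DD G t v ω},
        -({ω | K < DD G t u ω}).indicator (fun ω => |M' u ω|) ω ∂ℙ ≤
        ∫ ω in A ∩ {ω | K < DD G t v ω}, M' u ω ∂ℙ := by
      apply setIntegral_mono_on (hi2.mono_set Set.inter_subset_left).neg
        ((hM'i u).mono_set Set.inter_subset_left) hC'
      intro ω hω
      rw [Pi.neg_apply]
      by_cases h : K < DD G t u ω
      · rw [Set.indicator_of_mem (by exact h)]
        exact neg_abs_le (M' u ω)
      · rw [Set.indicator_of_notMem (by exact h)]
        have h9 := DD_nonpos_of G hvu ω (not_lt.1 h) hω.2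
        have h10 := Real.rpow_nonneg (hXnn u ω) r
        have h11 := congrFun (hXeq u) ω
        have : c₂ * DD G t u ω ≤ 0 := mul_nonpos_of_nonneg_of_nonpos hc₂.le h9
        linarith
    rw [integral_neg] at h8
    linarith
  have e7 := mul_le_mul_of_nonneg_left e2 hc₂.le
  linarith

lemma rpow_interp {X x r : ℝ} (hX : 0 ≤ X) (hx : 0 < x) (hr : 1 < r) :
    X ^ (r - 1) ≤ x ^ (r - 1) + X ^ r / x := by
  rcases le_or_gt X x with h | h
  · have h1 : X ^ (r - 1) ≤ x ^ (r - 1) := Real.rpow_le_rpow hX h (by linarith)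
    have h2 : 0 ≤ X ^ r / x := div_nonneg (Real.rpow_nonneg hX r) hx.le
    linarith
  · have hX0 : 0 < X := hx.trans h
    have h1 : X ^ r = X ^ (r - 1) * X := by
      rw [← Real.rpow_add_one hX0.ne']; congr 1; ring
    have h2 : X ^ (r - 1) ≤ X ^ r / x := by
      rw [le_div_iff₀ hx, h1]
      exact mul_le_mul_of_nonneg_left h.le (Real.rpow_nonneg hX _)
    have h3 : 0 ≤ x ^ (r - 1) := Real.rpow_nonneg hx.le _
    linarith

lemma momA2 {Ω : Type*} {m : MeasurableSpace Ω}
    (ℙ : Measure Ω) [IsProbabilityMeasure ℙ]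
    (X : ℝ≥0 → Ω → ℝ) (hXnn : ∀ v ω, 0 ≤ X v ω)
    (G : ℝ → Ω → ℝ≥0∞) (hG : Measurable (Function.uncurry G))
    (r : ℝ) (hr : 1 < r)
    (hGX : ∀ s ω, 0 ≤ s → G s ω ≤ ENNReal.ofReal (X s.toNNReal ω ^ (r - 1)))
    (t : ℝ≥0) (A : Set Ω) (hA : MeasurableSet A) (K : ℝ)
    (v : ℝ≥0) (htv : t ≤ v) (x : ℝ) (hx : 0 < x) (H : ℝ)
    (hDi : IntegrableOn (fun ω => max (DD G t v ω) 0) (A ∩ {ω | DD G t v ω ≤ K}) ℙ)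
    (hDm : ∀ w, MeasurableSet {ω | DD G t w ω ≤ K})
    (hXi : ∀ w, t ≤ w → w ≤ v → IntegrableOn (fun ω => X w ω ^ r) (A ∩ {ω | DD G t w ω ≤ K}) ℙ)
    (hH : ∀ w, t ≤ w → w ≤ v → ∫ ω in A ∩ {ω | DD G t w ω ≤ K}, X w ω ^ r ∂ℙ ≤ H) :
    ∫ ω in A ∩ {ω | DD G t v ω ≤ K}, max (DD G t v ω) 0 ∂ℙ ≤
      ((v : ℝ) - t) * (x ^ (r - 1) * ℙ.real A + H / x) := by
  have hH0 : 0 ≤ H := le_trans (integral_nonneg (fun ω => Real.rpow_nonneg (hXnn _ _) _))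
    (hH t le_rfl htv)
  have hvt : 0 ≤ (v : ℝ) - t := sub_nonneg.2 (NNReal.coe_le_coe.2 htv)
  have hR0 : 0 ≤ x ^ (r - 1) * ℙ.real A + H / x := by positivity
  set S : Set (ℝ × Ω) := {z | DD G t z.1.toNNReal z.2 ≤ K} with hS
  have hSm : MeasurableSet S := by
    apply measurableSet_le _ measurable_const
    apply Measurable.sub
    · exact (JJ_meas G hG).ennreal_toReal
    · have h0 : Measurable (fun z : ℝ × Ω => ((t:ℝ), z.2)) :=
        measurable_const.prodMk measurable_snd
      have := ((JJ_meas G hG).comp h0).ennreal_toReal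
      simpa [Function.comp_def] using this
  set F : ℝ → Ω → ℝ≥0∞ := fun s ω => S.indicator (Function.uncurry G) (s, ω) with hF
  have hFm : Measurable (Function.uncurry F) := hG.indicator hSm
  rw [← ENNReal.ofReal_le_ofReal_iff (mul_nonneg hvt hR0),
    ofReal_integral_eq_lintegral_ofReal hDi (Filter.Eventually.of_forall fun _ => le_max_right _ _)]
  calc ∫⁻ ω in A ∩ {ω | DD G t v ω ≤ K}, ENNReal.ofReal (max (DD G t v ω) 0) ∂ℙ
      ≤ ∫⁻ ω in A ∩ {ω | DD G t v ω ≤ K}, (∫⁻ s in Set.Ioc (t:ℝ) (v:ℝ), F s ω) ∂ℙ := by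
        apply setLIntegral_mono' (hA.inter (hDm v))
        intro ω hω
        rcases le_or_gt (DD G t v ω) 0 with h | h
        · rw [max_eq_right h]; simp
        · rw [max_eq_left h.le]
          refine (DD_le G htv ω h).trans (le_of_eq ?_)
          apply setLIntegral_congr_fun measurableSet_Ioc
          intro s hs
          have hmem : (s, ω) ∈ S := by
            have h1 : s.toNNReal ≤ v := Real.toNNReal_le_iff_le_coe.2 hs.2
            have h2 := DD_mono G h1 ω h
            have h3 : DD G t v ω ≤ K := hω.2
            exact h2.trans h3
          simp only [hF]
          rw [Set.indicator_of_mem hmem]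
          rfl
    _ ≤ ∫⁻ ω in A, (∫⁻ s in Set.Ioc (t:ℝ) (v:ℝ), F s ω) ∂ℙ :=
        lintegral_mono_set Set.inter_subset_left
    _ = ∫⁻ s in Set.Ioc (t:ℝ) (v:ℝ), (∫⁻ ω in A, F s ω ∂ℙ) := by
        apply lintegral_lintegral_swap
        exact (hFm.comp measurable_swap).aemeasurable
    _ ≤ ∫⁻ s in Set.Ioc (t:ℝ) (v:ℝ), ENNReal.ofReal (x ^ (r - 1) * ℙ.real A + H / x) := by
        apply setLIntegral_mono' measurableSet_Ioc
        intro s hs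
        have hs0 : 0 ≤ s := (NNReal.coe_nonneg t).trans hs.1.le
        have hw1 : t ≤ s.toNNReal := NNReal.le_toNNReal_of_coe_le hs.1.le
        have hw2 : s.toNNReal ≤ v := Real.toNNReal_le_iff_le_coe.2 hs.2
        have hXi' := hXi _ hw1 hw2
        have hci : IntegrableOn (fun _ : Ω => x ^ (r - 1)) (A ∩ {ω | DD G t s.toNNReal ω ≤ K}) ℙ :=
          integrable_const _
        calc ∫⁻ ω in A, F s ω ∂ℙ
            = ∫⁻ ω in A, ({ω | DD G t s.toNNReal ω ≤ K}).indicator (G s) ω ∂ℙ := rfl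
          _ = ∫⁻ ω in A ∩ {ω | DD G t s.toNNReal ω ≤ K}, G s ω ∂ℙ := by
              rw [setLIntegral_indicator (hDm _), Set.inter_comm]
          _ ≤ ∫⁻ ω in A ∩ {ω | DD G t s.toNNReal ω ≤ K},
                ENNReal.ofReal (x ^ (r - 1) + X s.toNNReal ω ^ r / x) ∂ℙ := by
              apply lintegral_mono
              intro ω
              exact (hGX s ω hs0).trans
                (ENNReal.ofReal_le_ofReal (rpow_interp (hXnn _ _) hx hr))
          _ = ENNReal.ofReal (∫ ω in A ∩ {ω | DD G t s.toNNReal ω ≤ K},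
                (x ^ (r - 1) + X s.toNNReal ω ^ r / x) ∂ℙ) := by
              have hadd : IntegrableOn (fun ω => x ^ (r - 1) + X s.toNNReal ω ^ r / x)
                  (A ∩ {ω | DD G t s.toNNReal ω ≤ K}) ℙ := hci.add (hXi'.div_const x)
              rw [ofReal_integral_eq_lintegral_ofReal hadd]
              refine Filter.Eventually.of_forall fun ω => ?_
              have := Real.rpow_nonneg (hXnn s.toNNReal ω) r
              simp only [Pi.zero_apply]
              positivity
          _ ≤ _ := by
              apply ENNReal.ofReal_le_ofReal
              rw [integral_add hci (hXi'.div_const x), integral_div, setIntegral_const, smul_eq_mul,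
                mul_comm]
              have h1 := hH _ hw1 hw2
              have h2 : ℙ.real (A ∩ {ω | DD G t s.toNNReal ω ≤ K}) ≤ ℙ.real A :=
                measureReal_mono Set.inter_subset_left
              gcongr
    _ = ENNReal.ofReal (((v : ℝ) - t) * (x ^ (r - 1) * ℙ.real A + H / x)) := by
        rw [setLIntegral_const, Real.volume_Ioc, mul_comm, ENNReal.ofReal_mul hvt]

/-- Moment bound. -/
lemma momA {Ω : Type*} {m : MeasurableSpace Ω}
    (𝒢 : MeasureTheory.Filtration ℝ≥0 m) (ℙ : Measure Ω) [IsProbabilityMeasure ℙ]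
    (X : ℝ≥0 → Ω → ℝ) (hXm : ∀ v, Measurable[𝒢 v] (X v)) (hXnn : ∀ v ω, 0 ≤ X v ω)
    (G : ℝ → Ω → ℝ≥0∞) (hG : Measurable (Function.uncurry G))
    (hIm : ∀ v, Measurable[𝒢 v] (fun ω => (JJ G v ω).toReal))
    (c₂ r : ℝ) (hc₂ : 0 < c₂) (hr : 1 < r)
    (hGX : ∀ s ω, 0 ≤ s → G s ω ≤ ENNReal.ofReal (X s.toNNReal ω ^ (r - 1)))
    (hsup : Supermartingale (fun (t : ℝ≥0) (ω : Ω) => X t ω ^ r - c₂ * (JJ G t ω).toReal) 𝒢 ℙ)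
    (t u : ℝ≥0) (htu : t ≤ u) (A : Set Ω) (hA : MeasurableSet[𝒢 t] A)
    (K₀ : ℝ) (hAI : ∀ ω ∈ A, (JJ G t ω).toReal ≤ K₀)
    (x : ℝ) (hx : 0 < x) (hAX : ∀ ω ∈ A, X t ω ≤ 2 * x)
    (hu : c₂ * ((u : ℝ) - t) ≤ x / 2) :
    ∫⁻ ω in A, ENNReal.ofReal (X u ω ^ r) ∂ℙ ≤
      ENNReal.ofReal ((2 * 2 ^ r + 1) * x ^ r * ℙ.real A) := by
  have hA' : MeasurableSet A := 𝒢.le t _ hA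
  have hI' : ∀ w, Measurable (fun ω => (JJ G w ω).toReal) := fun w =>
    (hIm w).mono (𝒢.le w) le_rfl
  have hX' : ∀ w, Measurable (X w) := fun w => (hXm w).mono (𝒢.le w) le_rfl
  have hD' : ∀ w, Measurable (DD G t w) := fun w => (hI' w).sub (hI' t)
  have hDm : ∀ K w, MeasurableSet {ω | DD G t w ω ≤ K} := fun K w => (hD' w) measurableSet_Iic
  have hut : 0 ≤ (u : ℝ) - t := sub_nonneg.2 (NNReal.coe_le_coe.2 htu)
  set e : ℝ → ℝ := fun K => ∫ ω in A ∩ {ω | K < DD G t u ω},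
        |X u ω ^ r - c₂ * (JJ G u ω).toReal + c₂ * (JJ G t ω).toReal| ∂ℙ with he
  have hXt : ∫ ω in A, X t ω ^ r ∂ℙ ≤ (2 * x) ^ r * ℙ.real A := by
    have hb : ∀ ω ∈ A, X t ω ^ r ≤ (2 * x) ^ r := fun ω hω =>
      Real.rpow_le_rpow (hXnn _ _) (hAX ω hω) (by linarith)
    have h_itg : IntegrableOn (fun ω => X t ω ^ r) A ℙ := by
      apply Measure.integrableOn_of_bounded (M := (2 * x) ^ r) (measure_ne_top _ _)
        ((hX' t).pow_const r).aestronglyMeasurable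
      filter_upwards [ae_restrict_mem hA'] with ω hω
      rw [Real.norm_of_nonneg (Real.rpow_nonneg (hXnn _ _) _)]
      exact hb ω hω
    calc ∫ ω in A, X t ω ^ r ∂ℙ ≤ ∫ ω in A, (2 * x) ^ r ∂ℙ :=
          setIntegral_mono_on h_itg (integrable_const _) hA' hb
      _ = _ := by rw [setIntegral_const, smul_eq_mul, mul_comm]
  have hxr : x ^ r = x ^ (r - 1) * x := by
    rw [← Real.rpow_add_one hx.ne']; congr 1; ring
  have key : ∀ K, 0 ≤ K → ∫ ω in A ∩ {ω | DD G t u ω ≤ K}, X u ω ^ r ∂ℙ ≤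
      2 * ((2 * x) ^ r * ℙ.real A + e K + x ^ r / 2 * ℙ.real A) := by
    intro K hK
    have h1 := fun v : Set.Icc t u => momA1 𝒢 ℙ X hXm hXnn G hIm c₂ r hc₂ hsup t u A hA K₀ K hK
      hAI v.1 v.2.1 v.2.2
    haveI : Nonempty (Set.Icc t u) := ⟨⟨t, le_rfl, htu⟩⟩
    refine sup_boot (fun v : Set.Icc t u => ∫ ω in A ∩ {ω | DD G t v.1 ω ≤ K}, X v.1 ω ^ r ∂ℙ)
      ((2 * x) ^ r * ℙ.real A + e K + x ^ r / 2 * ℙ.real A)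
      ((2 * x) ^ r * ℙ.real A + e K + c₂ * (K * 1)) ?_ ?_ ⟨u, htu, le_rfl⟩
    · intro v
      refine (h1 v).2.2.trans ?_
      have : ∫ ω in A ∩ {ω | DD G t v.1 ω ≤ K}, max (DD G t v.1 ω) 0 ∂ℙ ≤ K * 1 := by
        calc _ ≤ ∫ ω in A ∩ {ω | DD G t v.1 ω ≤ K}, K ∂ℙ := by
              apply setIntegral_mono_on (h1 v).2.1 (integrable_const _) (hA'.inter (hDm K v.1))
              intro ω hω
              exact max_le hω.2 hK
          _ = K * ℙ.real (A ∩ {ω | DD G t v.1 ω ≤ K}) := by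
              rw [setIntegral_const, smul_eq_mul, mul_comm]
          _ ≤ K * 1 := by gcongr; exact measureReal_le_one
      gcongr
    · intro H hH v
      have hH0 : 0 ≤ H := le_trans (integral_nonneg (fun ω => Real.rpow_nonneg (hXnn _ _) _))
        (hH v)
      refine (h1 v).2.2.trans ?_
      have h2 := momA2 ℙ X hXnn G hG r hr hGX t A hA' K v.1 v.2.1 x hx H (h1 v).2.1 (hDm K)
        (fun w hw1 hw2 => (h1 ⟨w, hw1, hw2.trans v.2.2⟩).1)
        (fun w hw1 hw2 => hH ⟨w, hw1, hw2.trans v.2.2⟩)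
      have h3 : ((v.1 : ℝ) - t) ≤ (u : ℝ) - t := by
        have : (v.1 : ℝ) ≤ u := NNReal.coe_le_coe.2 v.2.2
        linarith
      have h4 : c₂ * ∫ ω in A ∩ {ω | DD G t v.1 ω ≤ K}, max (DD G t v.1 ω) 0 ∂ℙ ≤
          x ^ r / 2 * ℙ.real A + H / 2 := by
        calc _ ≤ c₂ * (((u : ℝ) - t) * (x ^ (r - 1) * ℙ.real A + H / x)) := by
              apply mul_le_mul_of_nonneg_left _ hc₂.le
              refine h2.trans ?_
              apply mul_le_mul_of_nonneg_right h3
              positivity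
          _ = (c₂ * ((u : ℝ) - t)) * (x ^ (r - 1) * ℙ.real A + H / x) := by ring
          _ ≤ (x / 2) * (x ^ (r - 1) * ℙ.real A + H / x) := by
              apply mul_le_mul_of_nonneg_right hu
              positivity
          _ = _ := by rw [hxr]; field_simp
      simp only [he]
      linarith
  -- pass to the limit in K
  have hlim : Filter.Tendsto (fun n : ℕ => e n) Filter.atTop (nhds 0) := by
    have hIt : IntegrableOn (fun ω => c₂ * (JJ G t ω).toReal) A ℙ := by
      apply Integrable.const_mul
      apply Measure.integrableOn_of_bounded (M := K₀) (measure_ne_top _ _)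
        (hI' t).aestronglyMeasurable
      filter_upwards [ae_restrict_mem hA'] with ω hω
      rw [Real.norm_of_nonneg ENNReal.toReal_nonneg]
      exact hAI ω hω
    have hMi : IntegrableOn (fun ω =>
        |X u ω ^ r - c₂ * (JJ G u ω).toReal + c₂ * (JJ G t ω).toReal|) A ℙ :=
      (((hsup.integrable u).integrableOn).add hIt).abs
    have hinter : ⋂ n : ℕ, A ∩ {ω | (n : ℝ) < DD G t u ω} = ∅ := by
      rw [Set.eq_empty_iff_forall_notMem]
      intro ω hω
      obtain ⟨n, hn⟩ := exists_nat_ge (DD G t u ω)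
      have h2 : (n : ℝ) < DD G t u ω := (Set.mem_iInter.1 hω n).2
      linarith
    have := MeasureTheory.tendsto_setIntegral_of_antitone
      (s := fun n : ℕ => A ∩ {ω | (n : ℝ) < DD G t u ω}) (μ := ℙ)
      (f := fun ω => |X u ω ^ r - c₂ * (JJ G u ω).toReal + c₂ * (JJ G t ω).toReal|)
      (fun n => hA'.inter ((hD' u) measurableSet_Ioi))
      (by
        intro n k hnk ω hω
        refine ⟨hω.1, ?_⟩
        have h1 : (k : ℝ) < DD G t u ω := hω.2
        have h2 : (n : ℝ) ≤ k := by exact_mod_cast hnk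
        exact lt_of_le_of_lt h2 h1)
      ⟨0, hMi.mono_set Set.inter_subset_left⟩
    rw [hinter] at this
    simpa using this
  have hun : A = ⋃ n : ℕ, A ∩ {ω | DD G t u ω ≤ n} := by
    ext ω
    rw [Set.mem_iUnion]
    constructor
    · intro hω
      obtain ⟨n, hn⟩ := exists_nat_ge (DD G t u ω)
      exact ⟨n, hω, hn⟩
    · rintro ⟨n, hn⟩
      exact hn.1
  have hmono : Monotone fun n : ℕ => A ∩ {ω | DD G t u ω ≤ n} := by
    intro n k hnk ω hω
    refine ⟨hω.1, ?_⟩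
    have h1 : DD G t u ω ≤ n := hω.2
    have h2 : (n : ℝ) ≤ k := by exact_mod_cast hnk
    exact h1.trans h2
  have ht1 : Filter.Tendsto (fun n : ℕ =>
      ∫⁻ ω in A ∩ {ω | DD G t u ω ≤ n}, ENNReal.ofReal (X u ω ^ r) ∂ℙ) Filter.atTop
      (nhds (∫⁻ ω in A, ENNReal.ofReal (X u ω ^ r) ∂ℙ)) := by
    conv in (nhds _) => rw [hun]
    rw [setLIntegral_iUnion_of_directed _ (hmono.directed_le)]
    apply tendsto_atTop_iSup
    intro n k hnk
    exact lintegral_mono_set (hmono hnk)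
  have ht2 : Filter.Tendsto (fun n : ℕ => ENNReal.ofReal
      (2 * ((2 * x) ^ r * ℙ.real A + e n + x ^ r / 2 * ℙ.real A))) Filter.atTop
      (nhds (ENNReal.ofReal ((2 * 2 ^ r + 1) * x ^ r * ℙ.real A))) := by
    apply ENNReal.tendsto_ofReal
    have : (2 * 2 ^ r + 1) * x ^ r * ℙ.real A =
        2 * ((2 * x) ^ r * ℙ.real A + 0 + x ^ r / 2 * ℙ.real A) := by
      rw [Real.mul_rpow (by norm_num) hx.le]; ring
    rw [this]
    exact ((hlim.const_add _).add_const _).const_mul _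
  refine le_of_tendsto_of_tendsto' ht1 ht2 (fun n => ?_)
  have h1 := momA1 𝒢 ℙ X hXm hXnn G hIm c₂ r hc₂ hsup t u A hA K₀ n (Nat.cast_nonneg n)
      hAI u htu le_rfl
  rw [← ofReal_integral_eq_lintegral_ofReal h1.1
    (Filter.Eventually.of_forall fun ω => Real.rpow_nonneg (hXnn _ _) _)]
  exact ENNReal.ofReal_le_ofReal (key n (Nat.cast_nonneg n))

lemma le_interp {X l r : ℝ} (hX : 0 ≤ X) (hl : 0 < l) (hr : 1 < r) :
    X ≤ l + X ^ r / l ^ (r - 1) := by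
  have hlp : 0 < l ^ (r - 1) := Real.rpow_pos_of_pos hl _
  rcases le_or_gt X l with h | h
  · have h2 : 0 ≤ X ^ r / l ^ (r - 1) := div_nonneg (Real.rpow_nonneg hX r) hlp.le
    linarith
  · have hX0 : 0 < X := hl.trans h
    have h1 : X ^ r = X ^ (r - 1) * X := by
      rw [← Real.rpow_add_one hX0.ne']; congr 1; ring
    have h2 : X ≤ X ^ r / l ^ (r - 1) := by
      rw [le_div_iff₀ hlp, h1, mul_comm]
      exact mul_le_mul_of_nonneg_right (Real.rpow_le_rpow hl.le h.le (by linarith)) hX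
    linarith

/-- Survival estimate. -/
lemma survive {Ω : Type*} {m : MeasurableSpace Ω}
    (𝒢 : MeasureTheory.Filtration ℝ≥0 m) (ℙ : Measure Ω) [IsProbabilityMeasure ℙ]
    (X : ℝ≥0 → Ω → ℝ) (hXm : ∀ v, Measurable[𝒢 v] (X v)) (hXnn : ∀ v ω, 0 ≤ X v ω)
    (G : ℝ → Ω → ℝ≥0∞) (hG : Measurable (Function.uncurry G))
    (hIm : ∀ v, Measurable[𝒢 v] (fun ω => (JJ G v ω).toReal))
    (c₁ c₂ r : ℝ) (hc₁ : 0 < c₁) (hc₂ : 0 < c₂) (hr : 1 < r)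
    (hGX : ∀ s ω, 0 ≤ s → G s ω ≤ ENNReal.ofReal (X s.toNNReal ω ^ (r - 1)))
    (hsup : Supermartingale (fun (t : ℝ≥0) (ω : Ω) => X t ω ^ r - c₂ * (JJ G t ω).toReal) 𝒢 ℙ)
    (τ : ℝ≥0 → Ω → ℝ) (hτm : ∀ v, Measurable (τ v)) (hτ0 : ∀ v ω, 0 ≤ τ v ω)
    (hτv : ∀ v ω, τ v ω ≤ v)
    (hτd : ∀ v w ω, v ≤ w → τ w ω - τ v ω ≤ (w : ℝ) - v)
    (hsub : Submartingale (fun (t : ℝ≥0) (ω : Ω) => X t ω + c₁ * τ t ω) 𝒢 ℙ)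
    (t u : ℝ≥0) (htu : t ≤ u) (A : Set Ω) (hA : MeasurableSet[𝒢 t] A)
    (K₀ : ℝ) (hAI : ∀ ω ∈ A, (JJ G t ω).toReal ≤ K₀)
    (a x : ℝ) (ha : 0 < a) (hax : 2 * a ≤ x) (hAX : ∀ ω ∈ A, X t ω ≤ 2 * x)
    (hAX' : ∀ ω ∈ A, x ≤ X t ω)
    (hu : c₂ * ((u : ℝ) - t) ≤ x / 2) (hu' : c₁ * ((u : ℝ) - t) ≤ x / 4)
    (U : Set Ω) (hU : MeasurableSet U) (hXU : ∀ ω, ω ∉ U → X u ω ≤ a)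
    (L : ℝ) (hL : 0 < L) (hLC : 8 * (2 * 2 ^ r + 1) ≤ L ^ (r - 1)) :
    ℙ.real A ≤ 8 * L * ℙ.real (A ∩ U) := by
  have hx : 0 < x := by linarith
  have hA' : MeasurableSet A := 𝒢.le t _ hA
  have hX' : ∀ w, Measurable (X w) := fun w => (hXm w).mono (𝒢.le w) le_rfl
  have hmom := momA 𝒢 ℙ X hXm hXnn G hG hIm c₂ r hc₂ hr hGX hsup t u htu A hA K₀ hAI x hx hAX hu
  have hXri : IntegrableOn (fun ω => X u ω ^ r) A ℙ := by
    refine ⟨((hX' u).pow_const r).aestronglyMeasurable, ?_⟩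
    rw [hasFiniteIntegral_iff_ofReal
      (Filter.Eventually.of_forall fun ω => Real.rpow_nonneg (hXnn _ _) _)]
    exact lt_of_le_of_lt hmom ENNReal.ofReal_lt_top
  have hP : 0 ≤ ℙ.real A := measureReal_nonneg
  have hXr : ∫ ω in A, X u ω ^ r ∂ℙ ≤ (2 * 2 ^ r + 1) * x ^ r * ℙ.real A := by
    rw [← ENNReal.ofReal_le_ofReal_iff (by positivity), ofReal_integral_eq_lintegral_ofReal hXri
      (Filter.Eventually.of_forall fun ω => Real.rpow_nonneg (hXnn _ _) _)]
    exact hmom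
  have hτi : ∀ w, Integrable (fun ω => c₁ * τ w ω) ℙ := by
    intro w
    apply Integrable.const_mul
    apply Integrable.of_bound (hτm w).aestronglyMeasurable (w : ℝ)
    refine Filter.Eventually.of_forall fun ω => ?_
    rw [Real.norm_of_nonneg (hτ0 _ _)]
    exact hτv w ω
  have hXi : ∀ w, Integrable (X w) ℙ := by
    intro w
    have := (hsub.integrable w).sub (hτi w)
    refine this.congr (Filter.Eventually.of_forall fun ω => ?_)
    simp
  have h1 := hsub.setIntegral_le htu hA
  rw [integral_add (hXi t).integrableOn (hτi t).integrableOn,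
    integral_add (hXi u).integrableOn (hτi u).integrableOn] at h1
  have h2 : ∫ ω in A, c₁ * τ u ω ∂ℙ ≤ ∫ ω in A, (c₁ * τ t ω + x / 4) ∂ℙ := by
    apply integral_mono (hτi u).integrableOn ((hτi t).integrableOn.add (integrable_const _))
    intro ω
    have := mul_le_mul_of_nonneg_left (hτd t u ω htu) hc₁.le
    change c₁ * τ u ω ≤ c₁ * τ t ω + x / 4
    linarith
  rw [integral_add (hτi t).integrableOn (integrable_const _), setIntegral_const, smul_eq_mul] at h2
  have h3 : x * ℙ.real A ≤ ∫ ω in A, X t ω ∂ℙ := by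
    calc x * ℙ.real A = ∫ ω in A, x ∂ℙ := by rw [setIntegral_const, smul_eq_mul, mul_comm]
      _ ≤ _ := setIntegral_mono_on (integrable_const _) (hXi t).integrableOn hA' hAX'
  have hl : 0 < L * x := by positivity
  have hind : IntegrableOn (U.indicator fun _ : Ω => L * x) A ℙ :=
    Integrable.indicator (integrable_const _) hU
  have h4 : ∫ ω in A, X u ω ∂ℙ ≤
      ∫ ω in A, ((a + U.indicator (fun _ => L * x) ω) + X u ω ^ r / (L * x) ^ (r - 1)) ∂ℙ := by
    apply integral_mono (hXi u).integrableOn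
      (((integrable_const _).add hind).add (hXri.div_const _))
    intro ω
    by_cases hω : ω ∈ U
    · have := le_interp (hXnn u ω) hl hr
      change X u ω ≤ (a + U.indicator (fun _ => L * x) ω) + X u ω ^ r / (L * x) ^ (r - 1)
      rw [Set.indicator_of_mem hω]
      linarith
    · have h5 := hXU ω hω
      have : 0 ≤ X u ω ^ r / (L * x) ^ (r - 1) :=
        div_nonneg (Real.rpow_nonneg (hXnn _ _) _) (Real.rpow_nonneg hl.le _)
      change X u ω ≤ (a + U.indicator (fun _ => L * x) ω) + X u ω ^ r / (L * x) ^ (r - 1)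
      rw [Set.indicator_of_notMem hω]
      linarith
  have hca : IntegrableOn (fun _ : Ω => a) A ℙ := integrable_const _
  have hadd : IntegrableOn (fun ω => a + U.indicator (fun _ => L * x) ω) A ℙ := hca.add hind
  rw [integral_add hadd (hXri.div_const _), integral_add hca hind, setIntegral_const,
    setIntegral_indicator hU, setIntegral_const, integral_div, smul_eq_mul, smul_eq_mul] at h4
  have h6 : (∫ ω in A, X u ω ^ r ∂ℙ) / (L * x) ^ (r - 1) ≤ x / 8 * ℙ.real A := by
    rw [div_le_iff₀ (Real.rpow_pos_of_pos hl _)]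
    refine hXr.trans ?_
    have hxr : x ^ r = x ^ (r - 1) * x := by
      rw [← Real.rpow_add_one hx.ne']; congr 1; ring
    rw [Real.mul_rpow hL.le hx.le, hxr]
    have h7 : 0 ≤ x ^ (r - 1) * x * ℙ.real A / 8 := by positivity
    have h8 := mul_le_mul_of_nonneg_right hLC h7
    calc _ = 8 * (2 * 2 ^ r + 1) * (x ^ (r - 1) * x * ℙ.real A / 8) := by ring
      _ ≤ _ := h8
      _ = _ := by ring
  have h9 : a * ℙ.real A ≤ x / 2 * ℙ.real A := by
    apply mul_le_mul_of_nonneg_right _ hP; linarith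
  have h10 : x * (ℙ.real A / 8) ≤ x * (L * ℙ.real (A ∩ U)) := by nlinarith
  have h11 := le_of_mul_le_mul_left h10 hx
  linarith

/-- Comparison of moments. -/
lemma compare {Ω : Type*} {m : MeasurableSpace Ω}
    (𝒢 : MeasureTheory.Filtration ℝ≥0 m) (ℙ : Measure Ω) [IsProbabilityMeasure ℙ]
    (X : ℝ≥0 → Ω → ℝ) (hXm : ∀ v, Measurable[𝒢 v] (X v)) (hXnn : ∀ v ω, 0 ≤ X v ω)
    (G : ℝ → Ω → ℝ≥0∞) (hG : Measurable (Function.uncurry G))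
    (hIm : ∀ v, Measurable[𝒢 v] (fun ω => (JJ G v ω).toReal))
    (c₁ c₂ r : ℝ) (hc₁ : 0 < c₁) (hc₂ : 0 < c₂) (hr : 1 < r)
    (hGX : ∀ s ω, 0 ≤ s → G s ω ≤ ENNReal.ofReal (X s.toNNReal ω ^ (r - 1)))
    (hsup : Supermartingale (fun (t : ℝ≥0) (ω : Ω) => X t ω ^ r - c₂ * (JJ G t ω).toReal) 𝒢 ℙ)
    (τ : ℝ≥0 → Ω → ℝ) (hτm : ∀ v, Measurable (τ v)) (hτ0 : ∀ v ω, 0 ≤ τ v ω)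
    (hτv : ∀ v ω, τ v ω ≤ v)
    (hτd : ∀ v w ω, v ≤ w → τ w ω - τ v ω ≤ (w : ℝ) - v)
    (hsub : Submartingale (fun (t : ℝ≥0) (ω : Ω) => X t ω + c₁ * τ t ω) 𝒢 ℙ)
    (T : Ω → ℝ≥0∞) (hTm : ∀ v : ℝ≥0, MeasurableSet[𝒢 v] {ω | (v : ℝ≥0∞) < T ω})
    (a : ℝ) (ha : 0 < a) (hXT : ∀ (v : ℝ≥0) ω, T ω ≤ v → X v ω ≤ a)
    (q : ℝ) (hq : 0 < q) :
    ∃ C : ℝ≥0∞, C ≠ ⊤ ∧ ∀ t : ℝ≥0,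
      ∫⁻ ω in {ω | (t : ℝ≥0∞) < T ω} ∩ {ω | 2 * a ≤ X t ω}, ENNReal.ofReal (X t ω ^ q) ∂ℙ ≤
      C * ∫⁻ ω in {ω | (t : ℝ≥0∞) < T ω} ∩ {ω | 2 * a ≤ X t ω}, T ω ^ q ∂ℙ := by
  set L : ℝ := (8 * (2 * 2 ^ r + 1)) ^ (1 / (r - 1)) with hLdef
  have hL : 0 < L := by positivity
  have hLC : 8 * (2 * 2 ^ r + 1) ≤ L ^ (r - 1) := by
    rw [hLdef, ← Real.rpow_mul (by positivity), one_div, inv_mul_cancel₀ (by linarith),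
      Real.rpow_one]
  set δ : ℝ := min (1 / (2 * c₂)) (1 / (4 * c₁)) with hδdef
  have hδ : 0 < δ := by positivity
  have hδ2 : c₂ * δ ≤ 1 / 2 := by
    calc c₂ * δ ≤ c₂ * (1 / (2 * c₂)) := mul_le_mul_of_nonneg_left (min_le_left _ _) hc₂.le
      _ = 1 / 2 := by field_simp
  have hδ1 : c₁ * δ ≤ 1 / 4 := by
    calc c₁ * δ ≤ c₁ * (1 / (4 * c₁)) := mul_le_mul_of_nonneg_left (min_le_right _ _) hc₁.le
      _ = 1 / 4 := by field_simp
  refine ⟨ENNReal.ofReal ((2 / δ) ^ q * (8 * L)), ENNReal.ofReal_ne_top, fun t => ?_⟩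
  set V : Set Ω := {ω | (t : ℝ≥0∞) < T ω} ∩ {ω | 2 * a ≤ X t ω} with hV
  have hVm : MeasurableSet[𝒢 t] V := (hTm t).inter ((hXm t) measurableSet_Ici)
  set κ : Ω → ℕ × ℕ := fun ω => (⌊Real.logb 2 (X t ω / a)⌋₊, ⌊(JJ G t ω).toReal⌋₊) with hκ
  have hκm : Measurable[𝒢 t] κ := by
    apply Measurable.prodMk
    · apply Nat.measurable_floor.comp
      unfold Real.logb
      exact (Real.measurable_log.comp ((hXm t).div_const a)).div_const _
    · exact Nat.measurable_floor.comp (hIm t)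
  set A : ℕ × ℕ → Set Ω := fun i => V ∩ κ ⁻¹' {i} with hAdef
  have hAm : ∀ i, MeasurableSet[𝒢 t] (A i) := fun i => hVm.inter (hκm (measurableSet_singleton i))
  have hAm' : ∀ i, MeasurableSet (A i) := fun i => 𝒢.le t _ (hAm i)
  have hVU : V = ⋃ i, A i := by
    ext ω
    rw [Set.mem_iUnion]
    constructor
    · intro h; exact ⟨κ ω, h, rfl⟩
    · rintro ⟨i, hi⟩; exact hi.1
  have hdisj : Pairwise (Function.onFun Disjoint A) := by
    intro i j hij
    rw [Function.onFun, Set.disjoint_left]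
    intro ω h1 h2
    have e1 : κ ω = i := h1.2
    have e2 : κ ω = j := h2.2
    exact hij (e1.symm.trans e2)
  rw [hVU, lintegral_iUnion hAm' hdisj, lintegral_iUnion hAm' hdisj, ← ENNReal.tsum_mul_left]
  apply ENNReal.tsum_le_tsum
  intro i
  rcases (A i).eq_empty_or_nonempty with he | ⟨ω₀, hω₀⟩
  · rw [he]; simp
  set x : ℝ := 2 ^ i.1 * a with hx
  have hx0 : 0 < x := by positivity
  have hlog : ∀ ω ∈ A i, 1 ≤ i.1 ∧ x ≤ X t ω ∧ X t ω ≤ 2 * x := by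
    intro ω hω
    have hfl : ⌊Real.logb 2 (X t ω / a)⌋₊ = i.1 := congrArg Prod.fst (show κ ω = i from hω.2)
    have h2a : 2 * a ≤ X t ω := hω.1.2
    have h2 : 2 ≤ X t ω / a := by rw [le_div_iff₀ ha]; exact h2a
    have hpos : 0 < X t ω / a := by linarith
    have hlb : 1 ≤ Real.logb 2 (X t ω / a) := by
      rw [Real.le_logb_iff_rpow_le (by norm_num) hpos]; simpa using h2
    refine ⟨?_, ?_, ?_⟩
    · rw [← hfl]
      exact Nat.le_floor (by simpa using hlb)
    · have h3 := Nat.floor_le (show 0 ≤ Real.logb 2 (X t ω / a) by linarith)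
      rw [hfl, Real.le_logb_iff_rpow_le (by norm_num) hpos, Real.rpow_natCast,
        le_div_iff₀ ha] at h3
      exact h3
    · have h3 := (Nat.lt_floor_add_one (Real.logb 2 (X t ω / a))).le
      rw [hfl, Real.logb_le_iff_le_rpow (by norm_num) hpos] at h3
      rw [div_le_iff₀ ha] at h3
      have h4 : (2:ℝ) ^ ((i.1 : ℝ) + 1) = 2 * 2 ^ i.1 := by
        rw [Real.rpow_add_one (by norm_num), Real.rpow_natCast]; ring
      rw [h4] at h3
      rw [hx]; linarith
  have hax : 2 * a ≤ x := by
    have h1 := (hlog ω₀ hω₀).1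
    have : (2:ℝ) ^ 1 ≤ 2 ^ i.1 := pow_le_pow_right₀ (by norm_num) h1
    rw [hx]
    nlinarith
  set u : ℝ≥0 := t + (δ * x).toNNReal with hu
  have hut : (u : ℝ) - t = δ * x := by
    rw [hu, NNReal.coe_add, Real.coe_toNNReal _ (by positivity)]; ring
  have htu : t ≤ u := le_self_add
  have hAI : ∀ ω ∈ A i, (JJ G t ω).toReal ≤ (i.2 : ℝ) + 1 := by
    intro ω hω
    have hfl : ⌊(JJ G t ω).toReal⌋₊ = i.2 := congrArg Prod.snd (show κ ω = i from hω.2)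
    rw [← hfl]
    exact (Nat.lt_floor_add_one _).le
  have hUm : MeasurableSet {ω | (u : ℝ≥0∞) < T ω} := 𝒢.le u _ (hTm u)
  have hs := survive 𝒢 ℙ X hXm hXnn G hG hIm c₁ c₂ r hc₁ hc₂ hr hGX hsup τ hτm hτ0 hτv hτd hsub
    t u htu (A i) (hAm i) _ hAI a x ha hax (fun ω hω => (hlog ω hω).2.2)
    (fun ω hω => (hlog ω hω).2.1) (by rw [hut]; nlinarith) (by rw [hut]; nlinarith)
    {ω | (u : ℝ≥0∞) < T ω} hUm (fun ω hω => hXT u ω (not_lt.1 hω)) L hL hLC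
  have hs' : ℙ (A i) ≤ ENNReal.ofReal (8 * L) * ℙ (A i ∩ {ω | (u : ℝ≥0∞) < T ω}) := by
    rw [← ofReal_measureReal (s := A i), ← ofReal_measureReal (s := A i ∩ {ω | (u : ℝ≥0∞) < T ω}),
      ← ENNReal.ofReal_mul (by positivity)]
    exact ENNReal.ofReal_le_ofReal hs
  calc ∫⁻ ω in A i, ENNReal.ofReal (X t ω ^ q) ∂ℙ
      ≤ ∫⁻ ω in A i, ENNReal.ofReal ((2 * x) ^ q) ∂ℙ := by
        apply setLIntegral_mono' (hAm' i)
        intro ω hω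
        exact ENNReal.ofReal_le_ofReal
          (Real.rpow_le_rpow (hXnn _ _) (hlog ω hω).2.2 hq.le)
    _ = ENNReal.ofReal ((2 * x) ^ q) * ℙ (A i) := by rw [setLIntegral_const]
    _ ≤ ENNReal.ofReal ((2 * x) ^ q) * (ENNReal.ofReal (8 * L) *
          ℙ (A i ∩ {ω | (u : ℝ≥0∞) < T ω})) := by gcongr
    _ = ENNReal.ofReal ((2 / δ) ^ q * (8 * L)) *
          (ENNReal.ofReal ((δ * x) ^ q) * ℙ (A i ∩ {ω | (u : ℝ≥0∞) < T ω})) := by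
        rw [← mul_assoc (ENNReal.ofReal ((2 * x) ^ q)),
          ← mul_assoc (ENNReal.ofReal ((2 / δ) ^ q * (8 * L))),
          ← ENNReal.ofReal_mul (by positivity),
          ← ENNReal.ofReal_mul (by positivity)]
        congr 2
        have : 2 * x = (2 / δ) * (δ * x) := by field_simp
        rw [this, Real.mul_rpow (by positivity) (by positivity)]
        ring
    _ = ENNReal.ofReal ((2 / δ) ^ q * (8 * L)) *
          ∫⁻ ω in A i ∩ {ω | (u : ℝ≥0∞) < T ω}, ENNReal.ofReal ((δ * x) ^ q) ∂ℙ := by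
        rw [setLIntegral_const]
    _ ≤ ENNReal.ofReal ((2 / δ) ^ q * (8 * L)) *
          ∫⁻ ω in A i ∩ {ω | (u : ℝ≥0∞) < T ω}, T ω ^ q ∂ℙ := by
        gcongr 1
        apply setLIntegral_mono' ((hAm' i).inter hUm)
        intro ω hω
        rw [← ENNReal.ofReal_rpow_of_nonneg (by positivity) hq.le]
        apply ENNReal.rpow_le_rpow _ hq.le
        have h1 : (u : ℝ≥0∞) < T ω := hω.2
        refine le_trans ?_ h1.le
        rw [ENNReal.ofReal, ENNReal.coe_le_coe]
        exact le_add_self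
    _ ≤ _ := by
        gcongr 1
        exact lintegral_mono_set Set.inter_subset_left

/-- Dyadic-like grid points. -/
noncomputable def gridPt (n k : ℕ) : ℝ≥0 := ((k : ℝ≥0) + 1) / ((n : ℝ≥0) + 1)

lemma grid_tendsto (s : ℝ≥0) :
    Filter.Tendsto (fun n : ℕ => gridPt n ⌊((n : ℝ≥0) + 1) * s⌋₊) Filter.atTop
      (nhdsWithin s (Set.Ici s)) := by
  rw [tendsto_nhdsWithin_iff]
  have hlow : ∀ n : ℕ, s ≤ gridPt n ⌊((n : ℝ≥0) + 1) * s⌋₊ := by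
    intro n
    have hn : (0 : ℝ≥0) < (n : ℝ≥0) + 1 := by positivity
    unfold gridPt
    rw [le_div_iff₀ hn, mul_comm]
    exact (Nat.lt_floor_add_one _).le
  have hup : ∀ n : ℕ, gridPt n ⌊((n : ℝ≥0) + 1) * s⌋₊ ≤ s + 1 / ((n : ℝ≥0) + 1) := by
    intro n
    have hn : (0 : ℝ≥0) < (n : ℝ≥0) + 1 := by positivity
    unfold gridPt
    rw [div_le_iff₀ hn, add_mul s, one_div, inv_mul_cancel₀ hn.ne', mul_comm s]
    gcongr
    exact Nat.floor_le (by positivity)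
  refine ⟨?_, Filter.Eventually.of_forall hlow⟩
  refine tendsto_of_tendsto_of_tendsto_of_le_of_le tendsto_const_nhds ?_ hlow hup
  have h1 : Filter.Tendsto (fun n : ℕ => 1 / ((n : ℝ≥0) + 1)) Filter.atTop (nhds 0) :=
    tendsto_one_div_add_atTop_nhds_zero_nat
  simpa using h1.const_add s

lemma meas_index {Ω : Type*} {m : MeasurableSpace Ω} {W : ℕ → Ω → ℝ}
    (hW : ∀ k, Measurable (W k)) {φ : ℝ × Ω → ℕ} (hφ : Measurable φ) :
    Measurable (fun z : ℝ × Ω => W (φ z) z.2) := by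
  have h1 : Measurable (fun z : ℕ × Ω => W z.1 z.2) :=
    measurable_from_prod_countable_right (fun k => hW k)
  exact h1.comp (hφ.prodMk measurable_snd)

lemma RightCts.joint_meas {Ω : Type*} {m : MeasurableSpace Ω} {Y : ℝ≥0 → Ω → ℝ}
    (hY : RightCts Y) (hm : ∀ t, Measurable (Y t)) :
    Measurable (fun z : ℝ × Ω => Y z.1.toNNReal z.2) := by
  refine measurable_of_tendsto_metrizable (f := fun n : ℕ => fun z : ℝ × Ω =>
    Y (gridPt n ⌊((n : ℝ≥0) + 1) * z.1.toNNReal⌋₊) z.2) ?_ ?_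
  · intro n
    refine meas_index (W := fun k => Y (gridPt n k))
      (φ := fun z => ⌊((n : ℝ≥0) + 1) * z.1.toNNReal⌋₊) (fun k => hm (gridPt n k)) ?_
    apply Nat.measurable_floor.comp
    exact (measurable_real_toNNReal.comp measurable_fst).const_mul _
  · rw [tendsto_pi_nhds]
    intro z
    exact (hY z.2 z.1.toNNReal).comp (grid_tendsto _)

lemma RightCts.ae_le {Ω : Type*} {m : MeasurableSpace Ω} {ℙ : Measure Ω} {Y Z : ℝ≥0 → Ω → ℝ}
    (hY : RightCts Y) (hZ : RightCts Z) (b : ℝ)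
    (h : ∀ t : ℝ≥0, ∀ᵐ ω ∂ℙ, Y t ω ≤ b * Z t ω) :
    ∀ᵐ ω ∂ℙ, ∀ t, Y t ω ≤ b * Z t ω := by
  have h1 : ∀ᵐ ω ∂ℙ, ∀ i : ℕ × ℕ, Y (gridPt i.1 i.2) ω ≤ b * Z (gridPt i.1 i.2) ω :=
    ae_all_iff.2 fun i => h _
  filter_upwards [h1] with ω hω t
  refine le_of_tendsto_of_tendsto' ((hY ω t).comp (grid_tendsto t))
    (((hZ ω t).comp (grid_tendsto t)).const_mul b) (fun n => ?_)
  exact hω (n, _)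

lemma hit_le {Ω : Type*} {Y : ℝ≥0 → Ω → ℝ} {c : ℝ} {s : ℝ≥0} {ω : Ω} (h : Y s ω ≤ c) :
    hitTime Y c ω ≤ s := sInf_le ⟨s, h, rfl⟩

lemma lt_of_lt_hit {Ω : Type*} {Y : ℝ≥0 → Ω → ℝ} {c : ℝ} {s : ℝ≥0} {ω : Ω}
    (h : (s : ℝ≥0∞) < hitTime Y c ω) : c < Y s ω := by
  by_contra hcon
  exact absurd (hit_le (not_lt.1 hcon)) (not_le.2 h)

lemma RightCts.hit_attained {Ω : Type*} {Y : ℝ≥0 → Ω → ℝ} (hY : RightCts Y) {c : ℝ} {s : ℝ≥0}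
    {ω : Ω} (h : hitTime Y c ω = s) : Y s ω ≤ c := by
  by_contra hcon
  push Not at hcon
  have hev : ∀ᶠ s' in nhdsWithin s (Set.Ici s), c < Y s' ω :=
    (hY ω s).eventually (lt_mem_nhds hcon)
  obtain ⟨w, hw, hsub⟩ := (mem_nhdsGE_iff_exists_Ico_subset).1 hev
  have hlt : hitTime Y c ω < (w : ℝ≥0∞) := by rw [h]; exact_mod_cast hw
  obtain ⟨_, ⟨s', hs', rfl⟩, hs'w⟩ := sInf_lt_iff.1 hlt
  have h1 : s ≤ s' := by
    have := hit_le (Y := Y) (c := c) (ω := ω) hs'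
    rw [h] at this
    exact_mod_cast this
  have h2 : s' < w := ENNReal.coe_lt_coe.1 hs'w
  have h3 : c < Y s' ω := hsub ⟨h1, h2⟩
  have h4 : Y s' ω ≤ c := hs'
  linarith

lemma stopAt_coe {Ω : Type*} (Y : ℝ≥0 → Ω → ℝ) (c : ℝ) (t : ℝ≥0) (ω : Ω) :
    (stopAt Y c t ω : ℝ≥0∞) = min (t : ℝ≥0∞) (hitTime Y c ω) := by
  unfold stopAt
  exact ENNReal.coe_toNNReal (ne_top_of_le_ne_top ENNReal.coe_ne_top (min_le_left _ _))

lemma stopAt_le {Ω : Type*} (Y : ℝ≥0 → Ω → ℝ) (c : ℝ) (t : ℝ≥0) (ω : Ω) :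
    stopAt Y c t ω ≤ t := by
  rw [← ENNReal.coe_le_coe, stopAt_coe]; exact min_le_left _ _

lemma stopAt_eq {Ω : Type*} {Y : ℝ≥0 → Ω → ℝ} {c : ℝ} {t : ℝ≥0} {ω : Ω}
    (h : (t : ℝ≥0∞) ≤ hitTime Y c ω) : stopAt Y c t ω = t := by
  rw [← ENNReal.coe_inj, stopAt_coe, min_eq_left h]

lemma stopAt_hit {Ω : Type*} {Y : ℝ≥0 → Ω → ℝ} {c : ℝ} {t : ℝ≥0} {ω : Ω}
    (h : hitTime Y c ω ≤ t) : hitTime Y c ω = stopAt Y c t ω := by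
  rw [stopAt_coe, min_eq_right h]

lemma stopAt_incr {Ω : Type*} (Y : ℝ≥0 → Ω → ℝ) (c : ℝ) (v w : ℝ≥0) (ω : Ω) (hvw : v ≤ w) :
    (stopAt Y c w ω : ℝ) - stopAt Y c v ω ≤ (w : ℝ) - v := by
  have hvw' : (v : ℝ) ≤ w := by exact_mod_cast hvw
  rcases le_total (hitTime Y c ω) v with h | h
  · have h1 := stopAt_hit h
    have h2 := stopAt_hit (h.trans (by exact_mod_cast hvw : (v : ℝ≥0∞) ≤ w))
    rw [h1] at h2
    have h3 : stopAt Y c v ω = stopAt Y c w ω := by exact_mod_cast h2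
    rw [h3]; linarith
  · rw [stopAt_eq h]
    have : (stopAt Y c w ω : ℝ) ≤ w := by exact_mod_cast stopAt_le Y c w ω
    linarith

/-- Proposition (non-existence of moments): with `T_a` the hitting time of
`[0,a]` by `Z` and `S_{ab}` that of `[0,ab]` by `Y`, if `Z` satisfies the
drift bounds `E(dZ_t|𝒢_{t-}) ≥ -c₁ dt`, `E(dZ_t^r|𝒢_{t-}) ≤ c₂ Z_{t-}^{r-1} dt`
before `T_a`, starts at `z > a`, and `Y_0 = y` with `ab < y < bz`,
`Y ≤ b Z` a.s., and `(Y_{t∧S_{ab}}^p)` is a submartingale, then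
`E(T_a^q) = ∞` for all `q > p`. -/
theorem statement17 {Ω : Type*} {m : MeasurableSpace Ω}
    (𝒢 : MeasureTheory.Filtration ℝ≥0 m) (ℙ : Measure Ω) [IsProbabilityMeasure ℙ]
    (Y Z : ℝ≥0 → Ω → ℝ)
    (hYad : MeasureTheory.Adapted 𝒢 Y) (hZad : MeasureTheory.Adapted 𝒢 Z)
    (hYnn : ∀ t ω, 0 ≤ Y t ω) (hZnn : ∀ t ω, 0 ≤ Z t ω)
    (hYrc : RightCts Y) (hZrc : RightCts Z)
    (a c₁ c₂ r : ℝ) (ha : 0 < a) (hc₁ : 0 < c₁) (hc₂ : 0 < c₂) (hr : 1 < r)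
    (hsub : MeasureTheory.Submartingale
      (fun (t : ℝ≥0) (ω : Ω) => Z (stopAt Z a t ω) ω + c₁ * ((stopAt Z a t ω : ℝ≥0) : ℝ)) 𝒢 ℙ)
    (hsup : MeasureTheory.Supermartingale
      (fun (t : ℝ≥0) (ω : Ω) => Z (stopAt Z a t ω) ω ^ r
        - c₂ * ∫ s in Set.Ioc (0:ℝ) ((stopAt Z a t ω : ℝ≥0) : ℝ), Z s.toNNReal ω ^ (r - 1)) 𝒢 ℙ)
    (z : ℝ) (hz : a < z) (hZ0 : ∀ᵐ ω ∂ℙ, Z 0 ω = z)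
    (y b : ℝ) (hb : 0 < b) (hy1 : a * b < y) (hy2 : y < b * z)
    (hY0 : ∀ᵐ ω ∂ℙ, Y 0 ω = y)
    (hYZ : ∀ t : ℝ≥0, ∀ᵐ ω ∂ℙ, Y t ω ≤ b * Z t ω)
    (p : ℝ) (hp : 0 < p)
    (hsubp : MeasureTheory.Submartingale
      (fun (t : ℝ≥0) (ω : Ω) => Y (stopAt Y (a * b) t ω) ω ^ p) 𝒢 ℙ) :
    ∀ q : ℝ, p < q → ∫⁻ ω, hitTime Z a ω ^ q ∂ℙ = ⊤ := by
  intro q hpq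
  have hq : 0 < q := hp.trans hpq
  by_contra hfin
  set T : Ω → ℝ≥0∞ := hitTime Z a with hT
  set X : ℝ≥0 → Ω → ℝ := fun t ω => Z (stopAt Z a t ω) ω with hX
  have hXnn : ∀ v ω, 0 ≤ X v ω := fun v ω => hZnn _ _
  have hXa : ∀ (v : ℝ≥0) ω, T ω ≤ v → X v ω ≤ a := fun v ω h =>
    hZrc.hit_attained (stopAt_hit h)
  have hXZ : ∀ (v : ℝ≥0) ω, (v : ℝ≥0∞) ≤ T ω → X v ω = Z v ω := fun v ω h => by
    simp only [hX]; rw [stopAt_eq h]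
  -- T is a stopping time
  have hTm : ∀ v : ℝ≥0, MeasurableSet[𝒢 v] {ω | (v : ℝ≥0∞) < T ω} := by
    intro v
    have heq : {ω | (v : ℝ≥0∞) < T ω} = {ω | a < Z v ω} ∩
        {ω | Z (stopAt Z a v ω) ω + c₁ * ((stopAt Z a v ω : ℝ≥0) : ℝ) = Z v ω + c₁ * v} := by
      ext ω
      constructor
      · intro h
        have h' : (v : ℝ≥0∞) < hitTime Z a ω := h
        refine ⟨lt_of_lt_hit h', ?_⟩
        change Z (stopAt Z a v ω) ω + c₁ * ((stopAt Z a v ω : ℝ≥0) : ℝ) = Z v ω + c₁ * v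
        rw [stopAt_eq h'.le]
      · rintro ⟨h1, h2⟩
        have h1' : a < Z v ω := h1
        have h2' : Z (stopAt Z a v ω) ω + c₁ * ((stopAt Z a v ω : ℝ≥0) : ℝ) = Z v ω + c₁ * v := h2
        change (v : ℝ≥0∞) < T ω
        by_contra hcon
        have h3 : X v ω ≤ a := hXa v ω (not_lt.1 hcon)
        have h3' : Z (stopAt Z a v ω) ω ≤ a := h3
        have h4 : (stopAt Z a v ω : ℝ) ≤ v := by exact_mod_cast stopAt_le Z a v ω
        have h5 := mul_le_mul_of_nonneg_left h4 hc₁.le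
        linarith
    rw [heq]
    apply MeasurableSet.inter
    · exact (hZad v) measurableSet_Ioi
    · exact @measurableSet_eq_fun _ _ (𝒢 v) _ _ _ _ (hsub.1 v).measurable
        ((hZad v).add_const _)
  have hTmeas : Measurable T := by
    apply measurable_of_Ioi
    intro x
    induction x with
    | top => simp
    | coe x => exact 𝒢.le x _ (hTm x)
  have hτ𝒢 : ∀ v, Measurable[𝒢 v] (stopAt Z a v) := by
    intro v
    apply measurable_of_Ioi
    intro s
    rcases lt_or_ge s v with h | h
    · have : stopAt Z a v ⁻¹' Set.Ioi s = {ω | (s : ℝ≥0∞) < T ω} := by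
        ext ω
        change s < stopAt Z a v ω ↔ (s : ℝ≥0∞) < T ω
        rw [← ENNReal.coe_lt_coe, stopAt_coe, lt_min_iff]
        constructor
        · exact fun h => h.2
        · exact fun h' => ⟨by exact_mod_cast h, h'⟩
      rw [this]
      exact 𝒢.mono h.le _ (hTm s)
    · have : stopAt Z a v ⁻¹' Set.Ioi s = ∅ := by
        rw [Set.eq_empty_iff_forall_notMem]
        intro ω hω
        have h1 : s < stopAt Z a v ω := hω
        exact absurd (h1.trans_le (stopAt_le Z a v ω)) (not_lt.2 h)
      rw [this]
      exact @MeasurableSet.empty _ (𝒢 v)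
  set τ : ℝ≥0 → Ω → ℝ := fun v ω => ((stopAt Z a v ω : ℝ≥0) : ℝ) with hτ
  have hτm𝒢 : ∀ v, Measurable[𝒢 v] (τ v) := fun v => measurable_coe_nnreal_real.comp (hτ𝒢 v)
  have hXm : ∀ v, Measurable[𝒢 v] (X v) := by
    intro v
    have h1 := (hsub.1 v).measurable.sub ((hτm𝒢 v).const_mul c₁)
    have h2 : X v = (fun ω => Z (stopAt Z a v ω) ω + c₁ * ((stopAt Z a v ω : ℝ≥0) : ℝ)) -
        fun ω => c₁ * τ v ω := by
      ext ω; simp [hX, hτ]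
    rw [h2]; exact h1
  have hZmeas : ∀ v, Measurable (Z v) := fun v => (hZad v).mono (𝒢.le v) le_rfl
  have hZj := hZrc.joint_meas hZmeas
  set G : ℝ → Ω → ℝ≥0∞ := fun s ω =>
    ({z : ℝ × Ω | ENNReal.ofReal z.1 ≤ T z.2}).indicator
      (fun z => ENNReal.ofReal (Z z.1.toNNReal z.2 ^ (r - 1))) (s, ω) with hGdef
  have hSm : MeasurableSet {z : ℝ × Ω | ENNReal.ofReal z.1 ≤ T z.2} :=
    measurableSet_le (ENNReal.measurable_ofReal.comp measurable_fst)
      (hTmeas.comp measurable_snd)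
  have hG : Measurable (Function.uncurry G) :=
    ((hZj.pow_const (r - 1)).ennreal_ofReal).indicator hSm
  have hGX : ∀ s ω, 0 ≤ s → G s ω ≤ ENNReal.ofReal (X s.toNNReal ω ^ (r - 1)) := by
    intro s ω hs
    simp only [hGdef]
    by_cases h : (s, ω) ∈ {z : ℝ × Ω | ENNReal.ofReal z.1 ≤ T z.2}
    · rw [Set.indicator_of_mem h]
      have h' : ((s.toNNReal : ℝ≥0) : ℝ≥0∞) ≤ T ω := h
      rw [hXZ _ _ h']
    · rw [Set.indicator_of_notMem h]; simp
  have hJ : ∀ v ω, (JJ G v ω).toReal =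
      ∫ s in Set.Ioc (0:ℝ) ((stopAt Z a v ω : ℝ≥0) : ℝ), Z s.toNNReal ω ^ (r - 1) := by
    intro v ω
    have hpath : Measurable (fun s : ℝ => Z s.toNNReal ω ^ (r - 1)) :=
      (hZj.comp (measurable_id.prodMk measurable_const)).pow_const (r - 1)
    rw [integral_eq_lintegral_of_nonneg_ae
      (Filter.Eventually.of_forall fun s => Real.rpow_nonneg (hZnn _ _) _)
      hpath.aestronglyMeasurable]
    congr 1
    have hset : Set.Ioc (0:ℝ) ((stopAt Z a v ω : ℝ≥0) : ℝ) =
        {s : ℝ | ENNReal.ofReal s ≤ T ω} ∩ Set.Ioc (0:ℝ) (v:ℝ) := by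
      ext s
      have hiff : 0 < s → (s ≤ ((stopAt Z a v ω : ℝ≥0) : ℝ) ↔
          (s ≤ v ∧ ENNReal.ofReal s ≤ T ω)) := by
        intro hs
        rw [← Real.toNNReal_le_iff_le_coe, ← Real.toNNReal_le_iff_le_coe, ← ENNReal.coe_le_coe,
          stopAt_coe, le_min_iff, ENNReal.coe_le_coe]
        rfl
      constructor
      · intro h
        have h2 := (hiff h.1).1 h.2
        exact ⟨h2.2, h.1, h2.1⟩
      · rintro ⟨h1, h2⟩
        exact ⟨h2.1, (hiff h2.1).2 ⟨h2.2, h1⟩⟩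
    have hms : MeasurableSet {s : ℝ | ENNReal.ofReal s ≤ T ω} :=
      measurableSet_le ENNReal.measurable_ofReal measurable_const
    rw [hset, ← setLIntegral_indicator hms]
    rfl
  have hsup' : Supermartingale
      (fun (t : ℝ≥0) (ω : Ω) => X t ω ^ r - c₂ * (JJ G t ω).toReal) 𝒢 ℙ := by
    simp only [hJ]
    exact hsup
  have hIm : ∀ v, Measurable[𝒢 v] (fun ω => (JJ G v ω).toReal) := by
    intro v
    have h1 := (((hXm v).pow_const r).sub (hsup'.1 v).measurable).div_const c₂
    have h2 : (fun ω => (JJ G v ω).toReal) = fun ω =>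
        ((fun ω => X v ω ^ r) - (fun ω => X v ω ^ r - c₂ * (JJ G v ω).toReal)) ω / c₂ := by
      ext ω
      simp only [Pi.sub_apply]
      field_simp
      ring
    rw [h2]; exact h1
  obtain ⟨C, hC, hcomp⟩ := compare 𝒢 ℙ X hXm hXnn G hG hIm c₁ c₂ r hc₁ hc₂ hr hGX hsup' τ
    (fun v => (hτm𝒢 v).mono (𝒢.le v) le_rfl) (fun v ω => NNReal.coe_nonneg _)
    (fun v ω => by simpa [hτ] using stopAt_le Z a v ω)
    (fun v w ω h => stopAt_incr Z a v w ω h) hsub T hTm a ha hXa q hq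
  -- tails
  have hTtop : ∀ᵐ ω ∂ℙ, T ω < ⊤ := by
    have h1 := ae_lt_top (hTmeas.pow_const q) hfin
    filter_upwards [h1] with ω hω
    by_contra hcon
    rw [not_lt, top_le_iff] at hcon
    rw [hcon, ENNReal.top_rpow_of_pos hq] at hω
    exact lt_irrefl _ hω
  have hTm' : ∀ v : ℝ≥0, MeasurableSet {ω | (v : ℝ≥0∞) < T ω} := fun v => 𝒢.le v _ (hTm v)
  have hP0 : Filter.Tendsto (fun n : ℕ => ℙ {ω | ((n : ℝ≥0) : ℝ≥0∞) < T ω}) Filter.atTop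
      (nhds 0) := by
    have h1 := tendsto_measure_iInter_atTop (μ := ℙ)
      (s := fun n : ℕ => {ω | ((n : ℝ≥0) : ℝ≥0∞) < T ω})
      (fun n => (hTm' n).nullMeasurableSet)
      (by
        intro n k hnk ω hω
        have h1 : ((k : ℝ≥0) : ℝ≥0∞) < T ω := hω
        have h2 : ((n : ℝ≥0) : ℝ≥0∞) ≤ ((k : ℝ≥0) : ℝ≥0∞) := by exact_mod_cast hnk
        exact lt_of_le_of_lt h2 h1)
      ⟨0, measure_ne_top _ _⟩
    have h2 : ℙ (⋂ n : ℕ, {ω | ((n : ℝ≥0) : ℝ≥0∞) < T ω}) = 0 := by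
      rw [← nonpos_iff_eq_zero, ← ae_iff.1 hTtop]
      apply measure_mono
      intro ω hω
      change ¬ T ω < ⊤
      intro hlt
      obtain ⟨n, hn⟩ := ENNReal.exists_nat_gt hlt.ne
      have h3 : ((n : ℝ≥0) : ℝ≥0∞) < T ω := Set.mem_iInter.1 hω n
      have h4 : ((n : ℝ≥0) : ℝ≥0∞) = (n : ℝ≥0∞) := by simp
      rw [h4] at h3
      exact lt_asymm h3 hn
    rw [h2] at h1
    exact h1
  have hTq0 := tendsto_setLIntegral_zero hfin hP0
  have hYZ' := hYrc.ae_le hZrc b hYZ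
  have hab : 0 < a * b := by positivity
  -- main inequality
  have hmain : ∀ n : ℕ, ENNReal.ofReal (y ^ p) ≤ ENNReal.ofReal ((a * b) ^ p) +
      ENNReal.ofReal (b ^ p) * (ENNReal.ofReal ((2 * a) ^ p) * ℙ {ω | ((n : ℝ≥0) : ℝ≥0∞) < T ω} +
        ENNReal.ofReal ((2 * a) ^ (p - q)) *
          (C * ∫⁻ ω in {ω | ((n : ℝ≥0) : ℝ≥0∞) < T ω}, T ω ^ q ∂ℙ)) := by
    intro n
    have h1 := hsubp.setIntegral_le (zero_le : (0 : ℝ≥0) ≤ (n : ℝ≥0)) MeasurableSet.univ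
    simp only [Measure.restrict_univ] at h1
    have h2 : ∫ ω, Y (stopAt Y (a * b) 0 ω) ω ^ p ∂ℙ = y ^ p := by
      have : ∫ ω, Y (stopAt Y (a * b) 0 ω) ω ^ p ∂ℙ = ∫ ω, y ^ p ∂ℙ := by
        apply integral_congr_ae
        filter_upwards [hY0] with ω hω
        have h0 : stopAt Y (a * b) 0 ω = 0 := le_antisymm (stopAt_le _ _ _ _) zero_le
        rw [h0, hω]
      rw [this]; simp
    rw [h2] at h1
    have hXn : Measurable (X n) := (hXm n).mono (𝒢.le n) le_rfl
    calc ENNReal.ofReal (y ^ p) ≤ ENNReal.ofReal (∫ ω, Y (stopAt Y (a * b) n ω) ω ^ p ∂ℙ) :=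
          ENNReal.ofReal_le_ofReal h1
      _ = ∫⁻ ω, ENNReal.ofReal (Y (stopAt Y (a * b) n ω) ω ^ p) ∂ℙ :=
          ofReal_integral_eq_lintegral_ofReal (hsubp.integrable n)
            (Filter.Eventually.of_forall fun ω => Real.rpow_nonneg (hYnn _ _) _)
      _ ≤ ∫⁻ ω, (ENNReal.ofReal ((a * b) ^ p) + ({ω | ((n : ℝ≥0) : ℝ≥0∞) < T ω}).indicator
            (fun ω => ENNReal.ofReal (b ^ p) * ENNReal.ofReal (X n ω ^ p)) ω) ∂ℙ := by
          apply lintegral_mono_ae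
          filter_upwards [hYZ'] with ω hω
          rcases le_or_gt (hitTime Y (a * b) ω) ((n : ℝ≥0) : ℝ≥0∞) with h | h
          · have h3 := hYrc.hit_attained (stopAt_hit h)
            refine le_trans (ENNReal.ofReal_le_ofReal ?_) le_self_add
            exact Real.rpow_le_rpow (hYnn _ _) h3 hp.le
          · have hmem : ω ∈ {ω | ((n : ℝ≥0) : ℝ≥0∞) < T ω} := by
              change ((n : ℝ≥0) : ℝ≥0∞) < T ω
              by_contra hcon
              have h4 := not_lt.1 hcon
              have h5 := hXa n ω h4
              have h6 : Y (stopAt Z a n ω) ω ≤ a * b := by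
                refine (hω _).trans ?_
                rw [mul_comm]
                exact mul_le_mul_of_nonneg_right h5 hb.le
              have h7 := hit_le h6
              have h8 : ((stopAt Z a n ω : ℝ≥0) : ℝ≥0∞) ≤ ((n : ℝ≥0) : ℝ≥0∞) :=
                ENNReal.coe_le_coe.2 (stopAt_le Z a n ω)
              exact absurd (h7.trans h8) (not_le.2 h)
            rw [Set.indicator_of_mem hmem, stopAt_eq h.le]
            refine le_trans ?_ le_add_self
            rw [← ENNReal.ofReal_mul (by positivity), ← Real.mul_rpow hb.le (hXnn _ _)]
            apply ENNReal.ofReal_le_ofReal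
            apply Real.rpow_le_rpow (hYnn _ _) _ hp.le
            have hmem' : ((n : ℝ≥0) : ℝ≥0∞) < T ω := hmem
            rw [hXZ _ _ hmem'.le]
            exact hω _
      _ = ENNReal.ofReal ((a * b) ^ p) + ENNReal.ofReal (b ^ p) *
            ∫⁻ ω in {ω | ((n : ℝ≥0) : ℝ≥0∞) < T ω}, ENNReal.ofReal (X n ω ^ p) ∂ℙ := by
          rw [lintegral_add_left measurable_const, lintegral_const, measure_univ, mul_one,
            lintegral_indicator (hTm' n), lintegral_const_mul _ (hXn.pow_const p).ennreal_ofReal]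
      _ ≤ _ := by
          gcongr
          have hE : MeasurableSet {ω | 2 * a ≤ X n ω} := hXn measurableSet_Ici
          calc ∫⁻ ω in {ω | ((n : ℝ≥0) : ℝ≥0∞) < T ω}, ENNReal.ofReal (X n ω ^ p) ∂ℙ
              ≤ ∫⁻ ω in {ω | ((n : ℝ≥0) : ℝ≥0∞) < T ω}, (ENNReal.ofReal ((2 * a) ^ p) +
                ({ω | 2 * a ≤ X n ω}).indicator (fun ω => ENNReal.ofReal ((2 * a) ^ (p - q)) *
                  ENNReal.ofReal (X n ω ^ q)) ω) ∂ℙ := by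
                apply lintegral_mono
                intro ω
                by_cases h : 2 * a ≤ X n ω
                · have hmem : ω ∈ {ω | 2 * a ≤ X n ω} := h
                  simp only
                  rw [Set.indicator_of_mem hmem]
                  refine le_trans ?_ le_add_self
                  rw [← ENNReal.ofReal_mul (by positivity)]
                  apply ENNReal.ofReal_le_ofReal
                  have hXpos : 0 < X n ω := by linarith
                  have e1 : X n ω ^ p = X n ω ^ (p - q) * X n ω ^ q := by
                    rw [← Real.rpow_add hXpos]; congr 1; ring
                  rw [e1]
                  apply mul_le_mul_of_nonneg_right _ (by positivity)
                  exact Real.rpow_le_rpow_of_nonpos (by positivity) h (by linarith)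
                · refine le_trans (ENNReal.ofReal_le_ofReal ?_) le_self_add
                  exact Real.rpow_le_rpow (hXnn _ _) (not_le.1 h).le hp.le
            _ = ENNReal.ofReal ((2 * a) ^ p) * ℙ {ω | ((n : ℝ≥0) : ℝ≥0∞) < T ω} +
                ENNReal.ofReal ((2 * a) ^ (p - q)) *
                ∫⁻ ω in {ω | ((n : ℝ≥0) : ℝ≥0∞) < T ω} ∩ {ω | 2 * a ≤ X n ω},
                  ENNReal.ofReal (X n ω ^ q) ∂ℙ := by
                rw [lintegral_add_left measurable_const, setLIntegral_const,
                  setLIntegral_indicator hE, Set.inter_comm,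
                  lintegral_const_mul _ (hXn.pow_const q).ennreal_ofReal]
            _ ≤ _ := by
                gcongr
                refine (hcomp n).trans ?_
                gcongr
                exact Set.inter_subset_left
  have hlim : Filter.Tendsto (fun n : ℕ => ENNReal.ofReal ((a * b) ^ p) +
      ENNReal.ofReal (b ^ p) * (ENNReal.ofReal ((2 * a) ^ p) * ℙ {ω | ((n : ℝ≥0) : ℝ≥0∞) < T ω} +
        ENNReal.ofReal ((2 * a) ^ (p - q)) *
          (C * ∫⁻ ω in {ω | ((n : ℝ≥0) : ℝ≥0∞) < T ω}, T ω ^ q ∂ℙ))) Filter.atTop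
      (nhds (ENNReal.ofReal ((a * b) ^ p) +
      ENNReal.ofReal (b ^ p) * (ENNReal.ofReal ((2 * a) ^ p) * 0 +
        ENNReal.ofReal ((2 * a) ^ (p - q)) * (C * 0)))) := by
    apply Filter.Tendsto.const_add
    apply ENNReal.Tendsto.const_mul _ (Or.inr ENNReal.ofReal_ne_top)
    apply Filter.Tendsto.add
    · exact ENNReal.Tendsto.const_mul hP0 (Or.inr ENNReal.ofReal_ne_top)
    · apply ENNReal.Tendsto.const_mul _ (Or.inr ENNReal.ofReal_ne_top)
      exact ENNReal.Tendsto.const_mul hTq0 (Or.inr hC)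
  have hfinal := ge_of_tendsto' hlim hmain
  simp only [mul_zero, add_zero] at hfinal
  rw [ENNReal.ofReal_le_ofReal_iff (by positivity)] at hfinal
  have := Real.rpow_lt_rpow hab.le hy1 hp
  linarith
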